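/- Let p be an odd prime and F: V → F_{p^m} a vectorial dual-bent function satisfying Condition II with constant υ. Then N_1 := #{x ∈ V : F(x) is a nonzero square in F_{p^m}} = ((p^{n−m} + (−1)^{m−1} ϵ^m η_m(−1) υ p^{(n−m)/2})(p^m − 1))/2 and N_{−1} := #{x ∈ V : F(x) is a nonsquare} = ((p^{n−m} − (−1)^{m−1} ϵ^m η_m(−1) υ p^{(n−m)/2})(p^m − 1))/2. -/

import Mathlib

open Complex Finset

/-- `ζ_p^k` for `k ∈ Z/p`. -/
noncomputable def zetaP (p : ℕ) (k : ZMod p) : ℂ :=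
  Complex.exp (2 * Real.pi * Complex.I * (k.val : ℂ) / p)

/-- `ϵ = sqrt((-1)^{(p-1)/2})`: equal to `1` if `p ≡ 1 (mod 4)` and `i`
otherwise. -/
noncomputable def epsC (p : ℕ) : ℂ := if p % 4 = 1 then 1 else Complex.I

section GaussIdentity

variable {R : Type*} [Field R]

theorem sum_antidiagonal_neg_one_pow_mul_step {q : R} {a : ℕ → R} {N : ℕ}
    (ha : ∀ k < N, a (k + 1) * (1 - q ^ (k + 1)) = a k) {n : ℕ} (hn : n + 2 ≤ N) :
    (1 - q ^ (n + 2)) * ∑ x ∈ antidiagonal (n + 2), (-1) ^ x.1 * a x.1 * a x.2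
      = ∑ x ∈ antidiagonal n, (-1) ^ x.1 * a x.1 * a x.2 := by
  have left : ∀ l, l + 1 ≤ N →
      ∑ x ∈ antidiagonal (l + 1), (-1) ^ x.1 * (a x.1 * (1 - q ^ x.1)) * a x.2
        = -∑ x ∈ antidiagonal l, (-1) ^ x.1 * a x.1 * a x.2 := by
    intro l hl
    rw [Finset.Nat.sum_antidiagonal_succ, ← Finset.sum_neg_distrib]
    simp only [pow_zero, sub_self, mul_zero, zero_mul, zero_add]
    refine Finset.sum_congr rfl fun x hx => ?_
    rw [HasAntidiagonal.mem_antidiagonal] at hx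
    rw [ha x.1 (by omega)]
    ring
  have right : ∀ l, l + 1 ≤ N →
      ∑ x ∈ antidiagonal (l + 1), (-1) ^ x.1 * q ^ x.1 * a x.1 * (a x.2 * (1 - q ^ x.2))
        = ∑ x ∈ antidiagonal l, (-1) ^ x.1 * q ^ x.1 * a x.1 * a x.2 := by
    intro l hl
    rw [Finset.Nat.sum_antidiagonal_succ']
    simp only [pow_zero, sub_self, mul_zero, zero_add]
    refine Finset.sum_congr rfl fun x hx => ?_
    rw [HasAntidiagonal.mem_antidiagonal] at hx
    rw [ha x.2 (by omega)]
  have h1 := left (n + 1) hn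
  have h2 := right (n + 1) hn
  have h3 := left n (by omega)
  have h4 : (1 - q ^ (n + 2)) * ∑ x ∈ antidiagonal (n + 2), (-1) ^ x.1 * a x.1 * a x.2
      = ∑ x ∈ antidiagonal (n + 2), (-1) ^ x.1 * (a x.1 * (1 - q ^ x.1)) * a x.2
        + ∑ x ∈ antidiagonal (n + 2),
            (-1) ^ x.1 * q ^ x.1 * a x.1 * (a x.2 * (1 - q ^ x.2)) := by
    rw [Finset.mul_sum, ← Finset.sum_add_distrib]
    refine Finset.sum_congr rfl fun x hx => ?_
    rw [HasAntidiagonal.mem_antidiagonal] at hx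
    rw [← hx, pow_add]
    ring
  rw [h4, h1, h2, ← neg_inj, ← h3, neg_add, neg_neg, ← Finset.sum_neg_distrib,
    ← Finset.sum_add_distrib]
  exact Finset.sum_congr rfl fun x _ => by ring

theorem prod_mul_sum_antidiagonal_neg_one_pow {q : R} {a : ℕ → R} {N : ℕ}
    (ha : ∀ k < N, a (k + 1) * (1 - q ^ (k + 1)) = a k) (h : ℕ) (hh : 2 * h ≤ N) :
    (∏ j ∈ range h, (1 - q ^ (2 * j + 2)))
        * ∑ x ∈ antidiagonal (2 * h), (-1) ^ x.1 * a x.1 * a x.2 = a 0 * a 0 := by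
  induction h with
  | zero => simp
  | succ h ih =>
    rw [Finset.prod_range_succ, mul_assoc, show 2 * (h + 1) = 2 * h + 2 by ring,
      sum_antidiagonal_neg_one_pow_mul_step ha (by omega), ih (by omega)]

/-- Gauss's finite product for the quadratic theta sum at a root of unity of odd order. -/
theorem IsPrimitiveRoot.sum_pow_mul_succ_eq_prod {q ζ : R} {h : ℕ}
    (hq : IsPrimitiveRoot q (2 * h + 1)) (hζ : q * ζ ^ 2 = 1) :
    ∑ k ∈ range (2 * h + 1), ζ ^ (k * (k + 1)) = ∏ j ∈ range h, (1 - q ^ (2 * j + 1)) := by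
  have hne : ∀ k < 2 * h, 1 - q ^ (k + 1) ≠ 0 := fun k hk =>
    sub_ne_zero.mpr (hq.pow_ne_one_of_pos_of_lt (by omega) (by omega)).symm
  set P : ℕ → R := fun k => ∏ i ∈ range k, (1 - q ^ (i + 1)) with hP
  have hPne : ∀ k ≤ 2 * h, P k ≠ 0 := fun k hk =>
    Finset.prod_ne_zero_iff.mpr fun i hi => hne i (by rw [mem_range] at hi; omega)
  set a : ℕ → R := fun k => (P k)⁻¹ with ha_def
  have ha : ∀ k < 2 * h, a (k + 1) * (1 - q ^ (k + 1)) = a k := by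
    intro k hk
    have := hne k hk
    simp only [ha_def, hP, Finset.prod_range_succ, mul_inv]
    field_simp
  have hsplit : ∀ l, P (2 * l)
      = (∏ j ∈ range l, (1 - q ^ (2 * j + 1))) * ∏ j ∈ range l, (1 - q ^ (2 * j + 2)) := by
    intro l
    induction l with
    | zero => simp [hP]
    | succ l ih =>
      have : P (2 * (l + 1)) = P (2 * l) * (1 - q ^ (2 * l + 1)) * (1 - q ^ (2 * l + 2)) := by
        simp only [hP, show 2 * (l + 1) = 2 * l + 1 + 1 by ring, Finset.prod_range_succ]
      rw [this, ih, Finset.prod_range_succ, Finset.prod_range_succ]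
      ring
  have hterm : ∀ k ≤ 2 * h,
      ζ ^ (k * (k + 1)) = P (2 * h) * ((-1) ^ k * a k * a (2 * h - k)) := by
    intro k
    induction k with
    | zero =>
      intro _
      have h0 : a 0 = 1 := by simp [ha_def, hP]
      simp only [zero_mul, pow_zero, Nat.sub_zero, h0, one_mul]
      exact (mul_inv_cancel₀ (hPne (2 * h) le_rfl)).symm
    | succ k ih =>
      intro hk
      have e1 := ha k (by omega)
      have e2 := ha (2 * h - (k + 1)) (by omega)
      rw [show 2 * h - (k + 1) + 1 = 2 * h - k by omega] at e2
      have e3 : q ^ (2 * h - k) * q ^ (k + 1) = 1 := by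
        rw [← pow_add, show 2 * h - k + (k + 1) = 2 * h + 1 by omega, hq.pow_eq_one]
      have e4 : q ^ (k + 1) * ζ ^ (2 * (k + 1)) = 1 := by
        rw [pow_mul, ← mul_pow, hζ, one_pow]
      have e5 : q ^ (2 * h - k) = ζ ^ (2 * (k + 1)) := by
        have : q ^ (k + 1) ≠ 0 := left_ne_zero_of_mul_eq_one e4
        apply mul_left_cancel₀ this
        rw [e4, mul_comm, e3]
      rw [show (k + 1) * (k + 1 + 1) = k * (k + 1) + 2 * (k + 1) by ring, pow_add, ih (by omega),
        ← e2, ← e1]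
      rw [pow_succ (-1 : R), e5]
      clear_value a P
      linear_combination (-1 : R) ^ k * a (k + 1) * P (2 * h) * a (2 * h - k)
        * (-e4)
  have hsum := prod_mul_sum_antidiagonal_neg_one_pow ha h le_rfl
  rw [Finset.Nat.sum_antidiagonal_eq_sum_range_succ
    (fun i j => (-1 : R) ^ i * a i * a j)] at hsum
  have h0 : a 0 * a 0 = 1 := by simp [ha_def, hP]
  rw [Finset.sum_congr rfl fun k hk => hterm k (by rw [mem_range] at hk; omega),
    ← Finset.mul_sum, hsplit, mul_assoc, hsum, h0, mul_one]

end GaussIdentity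

theorem zetaP_eq_stdAddChar (p : ℕ) [NeZero p] (k : ZMod p) :
    zetaP p k = ZMod.stdAddChar k := by
  rw [zetaP, ZMod.stdAddChar_apply, ZMod.toCircle_apply]

theorem sum_quadraticChar_mul_eq_sum_sq {L : Type*} [Field L] [Fintype L] [DecidableEq L]
    (hL : ringChar L ≠ 2) {ψ : AddChar L ℂ} (hψ : ψ ≠ 1) :
    ∑ x : L, (quadraticChar L x : ℂ) * ψ x = ∑ x : L, ψ (x ^ 2) := by
  have hcard : ∀ a : L, (#{x : L | x ^ 2 = a} : ℂ) = quadraticChar L a + 1 := by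
    intro a
    have := quadraticChar_card_sqrts hL a
    rw [← Int.cast_one, ← Int.cast_add, ← this]
    simp
  rw [← Finset.sum_fiberwise (univ : Finset L) (fun x : L => x ^ 2) (fun x => ψ (x ^ 2))]
  have : ∀ a : L, ∑ x : L with x ^ 2 = a, ψ (x ^ 2) = (quadraticChar L a + 1) * ψ a := by
    intro a
    rw [← hcard, ← nsmul_eq_mul]
    exact Finset.sum_eq_card_nsmul fun x hx => by rw [(mem_filter.mp hx).2]
  simp_rw [this, add_mul, one_mul]
  rw [Finset.sum_add_distrib, AddChar.sum_eq_zero_of_ne_one hψ, add_zero]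

theorem sum_quadraticChar_mul_sq {L : Type*} [Field L] [Fintype L] [DecidableEq L]
    (hL : ringChar L ≠ 2) {ψ : AddChar L ℂ} (hψ : ψ.IsPrimitive) :
    (∑ x : L, (quadraticChar L x : ℂ) * ψ x) ^ 2
      = (quadraticChar L (-1) : ℂ) * Fintype.card L := by
  have hne : (quadraticChar L).ringHomComp (Int.castRingHom ℂ) ≠ 1 := by
    rw [Ne, MulChar.ringHomComp_eq_one_iff (RingHom.injective_int _)]
    exact quadraticChar_ne_one hL
  have := gaussSum_sq hne ((quadraticChar_isQuadratic L).comp _) hψ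
  simpa [gaussSum] using this

theorem sum_quadraticChar_mul_mulShift {L : Type*} [Field L] [Fintype L] [DecidableEq L]
    (ψ : AddChar L ℂ) {a : L} (ha : a ≠ 0) :
    ∑ x : L, (quadraticChar L x : ℂ) * ψ (a * x)
      = quadraticChar L a * ∑ x : L, (quadraticChar L x : ℂ) * ψ x := by
  have hsq : ((quadraticChar L a : ℤ) : ℂ) * (quadraticChar L a : ℂ) = 1 := by
    rw [← Int.cast_mul, ← sq, quadraticChar_sq_one ha, Int.cast_one]
  rw [Finset.mul_sum]
  refine Fintype.sum_bijective (a * ·) (mulLeft_bijective₀ a ha) _ _ fun x => ?_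
  simp only [map_mul, Int.cast_mul]
  linear_combination (-(quadraticChar L x : ℂ) * ψ (a * x)) * hsq

theorem sum_stdAddChar_sq_eq_prod_sin (h : ℕ) [NeZero (2 * h + 1)] :
    ∑ x : ZMod (2 * h + 1), (ZMod.stdAddChar (x ^ 2) : ℂ)
      = ∏ j ∈ range h,
          (2 * Complex.I * (Real.sin ((2 * j + 1) * (2 * Real.pi / (2 * h + 1))) : ℂ)) := by
  set p := 2 * h + 1 with hp
  set θ : ℝ := 2 * Real.pi / (2 * h + 1) with hθ
  set ζ : ℂ := Complex.exp (2 * Real.pi * Complex.I / p) with hζ_def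
  have hζ : IsPrimitiveRoot ζ p := Complex.isPrimitiveRoot_exp p (NeZero.ne p)
  have hζ0 : ζ ≠ 0 := Complex.exp_ne_zero _
  have hψ : ∀ k : ℕ, (ZMod.stdAddChar (k : ZMod p) : ℂ) = ζ ^ k := by
    intro k
    have := ZMod.stdAddChar_coe (N := p) k
    rw [Int.cast_natCast] at this
    rw [this, hζ_def, ← Complex.exp_nat_mul]
    congr 1
    push_cast
    ring
  have hq : IsPrimitiveRoot (ζ⁻¹ ^ 2) (2 * h + 1) :=
    hζ.inv.pow_of_coprime 2 (by simp [hp])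
  have hprod := hq.sum_pow_mul_succ_eq_prod (ζ := ζ) (by field_simp)
  have htwo : (2 : ZMod p) * h + 1 = 0 := by
    have := ZMod.natCast_self p
    rw [hp] at this
    push_cast at this
    exact this
  have hsum : ∑ x : ZMod p, (ZMod.stdAddChar (x ^ 2) : ℂ)
      = ζ ^ (h ^ 2) * ∑ k ∈ range p, ζ ^ (k * (k + 1)) := by
    rw [← Equiv.sum_comp (Equiv.addRight ((h : ZMod p) + 1)), Finset.mul_sum]
    refine Finset.sum_bij' (fun x _ => x.val) (fun k _ => (k : ZMod p))
      (fun x _ => mem_range.mpr (ZMod.val_lt x)) (fun _ _ => mem_univ _)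
      (fun x _ => ZMod.natCast_zmod_val x)
      (fun k hk => ZMod.val_cast_of_lt (mem_range.mp hk)) fun x _ => ?_
    rw [← pow_add, ← hψ]
    congr 1
    push_cast
    rw [ZMod.natCast_zmod_val, Equiv.coe_addRight]
    linear_combination (x + 1) * htwo
  have hodd : ∀ l, ∑ j ∈ range l, (2 * j + 1) = l ^ 2 := by
    intro l
    induction l with
    | zero => simp
    | succ l ih => rw [Finset.sum_range_succ, ih]; ring
  rw [hsum, hprod, ← hodd, ← Finset.prod_pow_eq_pow_sum, ← Finset.prod_mul_distrib]
  refine Finset.prod_congr rfl fun j _ => ?_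
  have hexp : ζ ^ (2 * j + 1) = Complex.exp (((2 * j + 1) * θ : ℝ) * Complex.I) := by
    rw [hζ_def, ← Complex.exp_nat_mul]
    congr 1
    rw [hθ, hp]
    push_cast
    ring
  have : ζ ^ (2 * j + 1) * (1 - (ζ⁻¹ ^ 2) ^ (2 * j + 1))
      = ζ ^ (2 * j + 1) - (ζ ^ (2 * j + 1))⁻¹ := by
    have hpow := pow_ne_zero (2 * j + 1) hζ0
    rw [pow_right_comm, inv_pow]
    generalize ζ ^ (2 * j + 1) = w at hpow ⊢
    field_simp
  rw [this, hexp, ← Complex.exp_neg, ← neg_mul, ← Complex.ofReal_neg, Complex.exp_mul_I,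
    Complex.exp_mul_I, Complex.ofReal_sin]
  push_cast
  rw [Complex.cos_neg, Complex.sin_neg]
  ring

/-- The sign of the quadratic Gauss sum over a prime field. -/
theorem sum_quadraticChar_mul_stdAddChar (p : ℕ) [Fact p.Prime] (hp : p ≠ 2) :
    ∑ x : ZMod p, (quadraticChar (ZMod p) x : ℂ) * ZMod.stdAddChar x
      = epsC p * (Real.sqrt p : ℂ) := by
  have hprim := ZMod.isPrimitive_stdAddChar p
  have hchar : ringChar (ZMod p) ≠ 2 := by rwa [ZMod.ringChar_zmod_n]
  have hne : (ZMod.stdAddChar : AddChar (ZMod p) ℂ) ≠ 1 := by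
    have := hprim one_ne_zero
    rwa [AddChar.mulShift_one] at this
  have hsq := sum_quadraticChar_mul_sq hchar hprim
  set G := ∑ x : ZMod p, (quadraticChar (ZMod p) x : ℂ) * ZMod.stdAddChar x with hG
  have hodd : p % 2 = 1 := (Fact.out : p.Prime).eq_two_or_odd.resolve_left hp
  obtain ⟨s, k, hpsk, hsk⟩ : ∃ s k, p = 2 * (s + k) + 1 ∧
      ((p % 4 = 1 ∧ s = k) ∨ (p % 4 = 3 ∧ s = k + 1)) := by
    rcases (by omega : p % 4 = 1 ∨ p % 4 = 3) with h | h
    · exact ⟨p / 4, p / 4, by omega, by omega⟩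
    · exact ⟨p / 4 + 1, p / 4, by omega, by omega⟩
  have hppos : (0 : ℝ) < p := by exact_mod_cast (Fact.out : p.Prime).pos
  obtain ⟨r, hr0, hr⟩ : ∃ r : ℝ, 0 < r ∧ G = epsC p * r := by
    have hprod : G = ∏ j ∈ range (s + k),
        (2 * Complex.I * (Real.sin ((2 * j + 1) * (2 * Real.pi / p)) : ℂ)) := by
      rw [hG, sum_quadraticChar_mul_eq_sum_sq hchar hne]
      clear_value G
      subst hpsk
      rw [sum_stdAddChar_sq_eq_prod_sin]
      push_cast
      rfl
    have hπ := Real.pi_pos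
    refine ⟨(∏ j ∈ range s, 2 * Real.sin ((2 * j + 1) * (2 * Real.pi / p)))
      * ∏ j ∈ range k, -(2 * Real.sin ((2 * (s + j : ℕ) + 1) * (2 * Real.pi / p))), ?_, ?_⟩
    · refine mul_pos (Finset.prod_pos fun j hj => ?_) (Finset.prod_pos fun j hj => ?_)
      · rw [mem_range] at hj
        refine mul_pos two_pos (Real.sin_pos_of_pos_of_lt_pi (by positivity) ?_)
        have : (2 * (2 * j + 1) : ℝ) < p := by
          have : 2 * (2 * j + 1) < p := by omega
          exact_mod_cast this
        rw [← mul_div_assoc, div_lt_iff₀ hppos]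
        nlinarith
      · rw [mem_range] at hj
        have h1 : (p : ℝ) < 2 * (2 * (s + j : ℕ) + 1) := by
          have : p < 2 * (2 * (s + j) + 1) := by omega
          exact_mod_cast this
        have h2 : (2 * (s + j : ℕ) + 1 : ℝ) < p := by
          have : 2 * (s + j) + 1 < p := by omega
          exact_mod_cast this
        have : Real.sin ((2 * (s + j : ℕ) + 1) * (2 * Real.pi / p) - 2 * Real.pi) < 0 := by
          refine Real.sin_neg_of_neg_of_neg_pi_lt ?_ ?_
          · rw [sub_neg, ← mul_div_assoc, div_lt_iff₀ hppos]
            nlinarith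
          · rw [neg_lt_sub_iff_lt_add, ← sub_lt_iff_lt_add', ← mul_div_assoc, lt_div_iff₀ hppos]
            nlinarith
        rw [Real.sin_sub_two_pi] at this
        linarith
    · rw [hprod, Finset.prod_range_add]
      have hI : Complex.I ^ s * (-Complex.I) ^ k = epsC p := by
        rcases hsk with ⟨h, rfl⟩ | ⟨h, rfl⟩
        · rw [← mul_pow, mul_neg, Complex.I_mul_I, neg_neg, one_pow, epsC, if_pos h]
        · rw [pow_succ, mul_right_comm, ← mul_pow, mul_neg, Complex.I_mul_I, neg_neg, one_pow,
            one_mul, epsC, if_neg (by omega)]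
      rw [← hI, Complex.ofReal_mul, Complex.ofReal_prod, Complex.ofReal_prod, mul_mul_mul_comm,
        show Complex.I ^ s = ∏ j ∈ range s, Complex.I by simp,
        show (-Complex.I) ^ k = ∏ j ∈ range k, -Complex.I by simp,
        ← Finset.prod_mul_distrib, ← Finset.prod_mul_distrib]
      congr 1 <;> refine Finset.prod_congr rfl fun j _ => ?_ <;> push_cast <;> ring
  have hepsnorm : ‖epsC p‖ = 1 := by
    unfold epsC
    split_ifs <;> simp
  have hnorm : r ^ 2 = p := by
    have := congrArg norm hsq
    rw [norm_pow, hr, norm_mul, hepsnorm, one_mul, Complex.norm_real, Real.norm_eq_abs,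
      sq_abs, norm_mul, ZMod.card, Complex.norm_natCast] at this
    rw [this]
    rcases quadraticChar_dichotomy (F := ZMod p) (a := -1) (by simp) with h | h <;> simp [h]
  rw [hr, ← hnorm, Real.sqrt_sq hr0.le]

theorem addChar_map_sum {ι A M : Type*} [AddCommMonoid A] [CommMonoid M] (ψ : AddChar A M)
    (s : Finset ι) (f : ι → A) : ψ (∑ i ∈ s, f i) = ∏ i ∈ s, ψ (f i) :=
  map_prod ψ.toMonoidHom (fun i => Multiplicative.ofAdd (f i)) s

theorem trace_sum_smul_sq_of_isOrtho {p : ℕ} [Fact p.Prime] {K : Type*} [Field K]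
    [Algebra (ZMod p) K] {m : ℕ} {b : Fin m → K}
    (hb : (Algebra.traceForm (ZMod p) K).IsOrthoᵢ b) (y : Fin m → ZMod p) :
    Algebra.trace (ZMod p) K ((∑ i, y i • b i) ^ 2)
      = ∑ i, Algebra.trace (ZMod p) K (b i * b i) * y i ^ 2 := by
  rw [sq, Finset.sum_mul_sum, map_sum]
  refine Finset.sum_congr rfl fun i _ => ?_
  rw [map_sum, Finset.sum_eq_single i]
  · rw [smul_mul_smul_comm, map_smul, smul_eq_mul]
    ring
  · intro j _ hj
    have : Algebra.trace (ZMod p) K (b i * b j) = 0 := hb hj.symm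
    rw [smul_mul_smul_comm, map_smul, this, smul_zero]
  · simp

section TraceForm

variable {p : ℕ} [Fact p.Prime] {K : Type*} [Field K] [Fintype K] [Algebra (ZMod p) K]

theorem exists_sq_eq_discr_and_pow_card_eq {k : ℕ} (hk : Module.finrank (ZMod p) K = k + 1)
    (b : Fin (k + 1) → K) :
    ∃ δ : K, δ ^ 2 = algebraMap (ZMod p) K (Algebra.discr (ZMod p) b) ∧ δ ^ p = (-1) ^ k * δ := by
  have : CharP K p := charP_of_injective_algebraMap (algebraMap (ZMod p) K).injective p
  have hcard : Fintype.card K = p ^ (k + 1) := by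
    rw [Module.card_eq_pow_finrank (K := ZMod p) (V := K), ZMod.card, hk]
  set M : Matrix (Fin (k + 1)) (Fin (k + 1)) K := Matrix.of fun i j => b j ^ p ^ (i : ℕ) with hM
  refine ⟨M.det, ?_, ?_⟩
  · have hMM : M.transpose * M = (Algebra.traceMatrix (ZMod p) b).map (algebraMap (ZMod p) K) := by
      ext i j
      rw [Matrix.mul_apply, Matrix.map_apply, Algebra.traceMatrix_apply, Algebra.traceForm_apply,
        FiniteField.algebraMap_trace_eq_sum_pow, hk, Nat.card_zmod, Finset.sum_range]
      simp [hM, mul_pow]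
    rw [Algebra.discr_def, RingHom.map_det, RingHom.mapMatrix_apply, ← hMM, Matrix.det_mul,
      Matrix.det_transpose, sq]
  · have hrot : M.map (frobenius K p) = M.submatrix (finRotate (k + 1)) id := by
      ext i j
      simp only [hM, Matrix.map_apply, Matrix.of_apply, Matrix.submatrix_apply, id, frobenius_def,
        ← pow_mul, ← pow_succ]
      rcases eq_or_ne i (Fin.last k) with rfl | hi
      · rw [finRotate_last, Fin.val_last, Fin.val_zero, pow_zero, pow_one, ← hcard,
          FiniteField.pow_card]
      · rw [coe_finRotate_of_ne_last hi]
    have := RingHom.map_det (frobenius K p) M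
    rw [RingHom.mapMatrix_apply, hrot, Matrix.det_permute, sign_finRotate, frobenius_def] at this
    simpa using this

theorem quadraticChar_discr (hp : p ≠ 2) {m : ℕ} (hm : Module.finrank (ZMod p) K = m)
    (b : Module.Basis (Fin m) (ZMod p) K) :
    quadraticChar (ZMod p) (Algebra.discr (ZMod p) b) = (-1) ^ (m - 1) := by
  have : CharP K p := charP_of_injective_algebraMap (algebraMap (ZMod p) K).injective p
  obtain ⟨k, rfl⟩ : ∃ k, m = k + 1 :=
    Nat.exists_eq_succ_of_ne_zero (hm ▸ Module.finrank_pos.ne')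
  have hodd : p % 2 = 1 := (Fact.out : p.Prime).eq_two_or_odd.resolve_left hp
  have hdisc : Algebra.discr (ZMod p) b ≠ 0 := Algebra.discr_not_zero_of_basis (ZMod p) b
  have hchar : ringChar (ZMod p) ≠ 2 := by rwa [ZMod.ringChar_zmod_n]
  have hchar' : ringChar K ≠ 2 := by rwa [ringChar.eq K p]
  obtain ⟨δ, hδ, hδp⟩ := exists_sq_eq_discr_and_pow_card_eq hm b
  have hδ0 : δ ≠ 0 := by
    rintro rfl
    rw [zero_pow two_ne_zero, eq_comm, map_eq_zero] at hδ
    exact hdisc hδ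
  have hpow : algebraMap (ZMod p) K (Algebra.discr (ZMod p) b) ^ (p / 2) = (-1) ^ k := by
    rw [← hδ, ← pow_mul]
    apply mul_right_cancel₀ hδ0
    rw [← pow_succ, show 2 * (p / 2) + 1 = p by omega, hδp]
  have hval := quadraticChar_eq_pow_of_char_ne_two' hchar (Algebra.discr (ZMod p) b)
  have hval' : ((quadraticChar (ZMod p) (Algebra.discr (ZMod p) b) : ℤ) : K)
      = (((-1) ^ k : ℤ) : K) := by
    rw [ZMod.card p] at hval
    rw [← map_intCast (algebraMap (ZMod p) K), hval, map_pow, hpow]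
    push_cast
    rfl
  have hne : (-1 : K) ≠ 1 := Ring.neg_one_ne_one_of_char_ne_two hchar'
  rw [Nat.add_sub_cancel]
  rcases quadraticChar_dichotomy hdisc with h | h <;>
    rcases neg_one_pow_eq_or ℤ k with h' | h' <;>
    rw [h, h'] at hval' ⊢ <;>
    simp only [Int.cast_neg, Int.cast_one] at hval'
  · exact absurd hval'.symm hne
  · exact absurd hval' hne

theorem traceAddChar_isPrimitive :
    ((ZMod.stdAddChar : AddChar (ZMod p) ℂ).compAddMonoidHom
      (Algebra.trace (ZMod p) K).toAddMonoidHom).IsPrimitive := by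
  refine AddChar.IsPrimitive.of_ne_one fun h => ?_
  obtain ⟨x, hx⟩ := Algebra.trace_surjective (ZMod p) K 1
  have h1 := DFunLike.congr_fun h x
  have h2 : (ZMod.stdAddChar (1 : ZMod p) : ℂ) = 1 := by
    rw [← hx]
    exact h1
  rw [← AddChar.map_zero_eq_one (ZMod.stdAddChar : AddChar (ZMod p) ℂ),
    ZMod.injective_stdAddChar.eq_iff] at h2
  exact one_ne_zero h2

/-- The quadratic Gauss sum over a finite field of odd characteristic. -/
theorem sum_quadraticChar_mul_stdAddChar_trace [DecidableEq K] (hp : p ≠ 2) {m : ℕ}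
    (hK : Fintype.card K = p ^ m) :
    ∑ x : K, (quadraticChar K x : ℂ) * ZMod.stdAddChar (Algebra.trace (ZMod p) K x)
      = (-1) ^ (m - 1) * epsC p ^ m * (Real.sqrt p : ℂ) ^ m := by
  have : CharP K p := charP_of_injective_algebraMap (algebraMap (ZMod p) K).injective p
  have hchar : ringChar (ZMod p) ≠ 2 := by rwa [ZMod.ringChar_zmod_n]
  have hchar' : ringChar K ≠ 2 := by rwa [ringChar.eq K p]
  have hm : Module.finrank (ZMod p) K = m := by
    rw [Module.card_eq_pow_finrank (K := ZMod p) (V := K), ZMod.card] at hK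
    exact Nat.pow_right_injective (Fact.out : p.Prime).two_le hK
  have : Invertible (2 : ZMod p) := invertibleOfNonzero (Ring.two_ne_zero hchar)
  obtain ⟨b, hb⟩ := LinearMap.BilinForm.exists_orthogonal_basis
    (B := Algebra.traceForm (ZMod p) K) ⟨fun x y => by
      simp [Algebra.traceForm_apply, mul_comm]⟩
  have hdiscr := quadraticChar_discr hp rfl b
  have hprim := ZMod.isPrimitive_stdAddChar p
  set t : Fin _ → ZMod p := fun i => Algebra.trace (ZMod p) K (b i * b i) with ht
  have hprod : Algebra.discr (ZMod p) b = ∏ i, t i := by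
    rw [Algebra.discr_def, ← Matrix.det_diagonal]
    congr 1
    ext i j
    rcases eq_or_ne i j with rfl | hij
    · simp [Algebra.traceMatrix_apply, Algebra.traceForm_apply, ht]
    · rw [Matrix.diagonal_apply_ne _ hij, Algebra.traceMatrix_apply]
      exact hb hij
  have ht0 : ∀ i, t i ≠ 0 := by
    have := Algebra.discr_not_zero_of_basis (ZMod p) b
    rw [hprod, Finset.prod_ne_zero_iff] at this
    exact fun i => this i (mem_univ i)
  have hone : ∀ a : ZMod p, a ≠ 0 → ∑ y : ZMod p, (ZMod.stdAddChar (a * y ^ 2) : ℂ)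
      = quadraticChar (ZMod p) a * (epsC p * (Real.sqrt p : ℂ)) := by
    intro a ha
    rw [← sum_quadraticChar_mul_stdAddChar p hp, ← sum_quadraticChar_mul_mulShift _ ha]
    exact (sum_quadraticChar_mul_eq_sum_sq hchar (hprim ha)).symm
  have hsq := sum_quadraticChar_mul_eq_sum_sq (L := K) hchar'
    (ψ := (ZMod.stdAddChar : AddChar (ZMod p) ℂ).compAddMonoidHom
      (Algebra.trace (ZMod p) K).toAddMonoidHom)
    (by
      have := traceAddChar_isPrimitive (p := p) (K := K) one_ne_zero
      rwa [AddChar.mulShift_one] at this)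
  calc ∑ x : K, (quadraticChar K x : ℂ) * ZMod.stdAddChar (Algebra.trace (ZMod p) K x)
      = ∑ x : K, (ZMod.stdAddChar (Algebra.trace (ZMod p) K (x ^ 2)) : ℂ) := hsq
    _ = ∑ y : Fin _ → ZMod p, ∏ i, (ZMod.stdAddChar (t i * y i ^ 2) : ℂ) := by
        rw [← Equiv.sum_comp b.equivFun.symm.toEquiv]
        refine Finset.sum_congr rfl fun y _ => ?_
        rw [LinearEquiv.coe_toEquiv, Module.Basis.equivFun_symm_apply,
          trace_sum_smul_sq_of_isOrtho hb, addChar_map_sum]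
    _ = ∏ i, ∑ y : ZMod p, (ZMod.stdAddChar (t i * y ^ 2) : ℂ) := by
        rw [Finset.prod_univ_sum, Fintype.piFinset_univ]
    _ = ∏ i, (quadraticChar (ZMod p) (t i) * (epsC p * (Real.sqrt p : ℂ))) :=
        Finset.prod_congr rfl fun i _ => hone _ (ht0 i)
    _ = _ := by
        rw [Finset.prod_mul_distrib, ← Int.cast_prod, ← map_prod, ← hprod, hdiscr,
          Finset.prod_const, Finset.card_univ, Fintype.card_fin, hm]
        push_cast
        ring

end TraceForm

/-- Under Condition II with constant `υ`, the counts
`N_1 = #{x : F(x) nonzero square}` and `N_{-1} = #{x : F(x) nonsquare}`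
satisfy `2 N_1 = (p^{n-m} + (-1)^{m-1} ϵ^m η_m(-1) υ p^{(n-m)/2})(p^m - 1)`
and `2 N_{-1} = (p^{n-m} - (-1)^{m-1} ϵ^m η_m(-1) υ p^{(n-m)/2})(p^m - 1)`. -/
theorem count_square_values_condII
    (p n m d : ℕ) [Fact p.Prime] (hp : p ≠ 2)
    (hm : 1 ≤ m) (hmn : m ≤ n) (hnm : Even (n - m)) (hn3m : 3 * m ≤ n)
    (V : Type*) [AddCommGroup V] [Module (ZMod p) V] [Fintype V]
    (hV : Fintype.card V = p ^ n)
    (K : Type*) [Field K] [Fintype K] [DecidableEq K] [Algebra (ZMod p) K]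
    (hK : Fintype.card K = p ^ m)
    (B : V →ₗ[ZMod p] V →ₗ[ZMod p] ZMod p)
    (hBsym : ∀ v w, B v w = B w v)
    (hBnd : ∀ v, (∀ w, B v w = 0) → v = 0)
    (F Fstar : V → K)
    (υ : ℂ) (hυ : υ = epsC p ^ m ∨ υ = -(epsC p ^ m))
    (hd : 2 ≤ d) (hdeven : Even d)
    (hgcd : Nat.gcd (d - 1) (p ^ m - 1) = 1)
    (hF0 : F 0 = 0) (hFstar0 : Fstar 0 = 0)
    (hFstarneg : ∀ a : V, Fstar (-a) = Fstar a)
    (hWalsh : ∀ c : K, c ≠ 0 → ∀ a : V,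
      ∑ x : V, zetaP p (Algebra.trace (ZMod p) K (c * F x) - B a x)
        = υ * (quadraticChar K c : ℂ) * (Real.sqrt ((p : ℝ) ^ n) : ℂ)
            * zetaP p (Algebra.trace (ZMod p) K (c ^ ((1 : ℤ) - d) * Fstar a))) :
    (2 * ((Finset.univ.filter
          (fun x : V => IsSquare (F x) ∧ F x ≠ 0)).card : ℂ)
      = ((p : ℂ) ^ (n - m)
          + (-1) ^ (m - 1) * epsC p ^ m * (quadraticChar K (-1) : ℂ) * υ
            * (p : ℂ) ^ ((n - m) / 2)) * ((p : ℂ) ^ m - 1))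
    ∧ (2 * ((Finset.univ.filter
          (fun x : V => ¬ IsSquare (F x))).card : ℂ)
      = ((p : ℂ) ^ (n - m)
          - (-1) ^ (m - 1) * epsC p ^ m * (quadraticChar K (-1) : ℂ) * υ
            * (p : ℂ) ^ ((n - m) / 2)) * ((p : ℂ) ^ m - 1)) := by
  classical
  have : CharP K p := charP_of_injective_algebraMap (algebraMap (ZMod p) K).injective p
  have hchar : ringChar K ≠ 2 := by rwa [ringChar.eq K p]
  have hppos : (0 : ℝ) < p := by exact_mod_cast (Fact.out : p.Prime).pos
  have hp0 : (p : ℂ) ≠ 0 := by exact_mod_cast (Fact.out : p.Prime).ne_zero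
  have hsqrt : (Real.sqrt p : ℂ) ^ 2 = p := by
    rw [← Complex.ofReal_pow, Real.sq_sqrt hppos.le, Complex.ofReal_natCast]
  set ψ : AddChar K ℂ := (ZMod.stdAddChar : AddChar (ZMod p) ℂ).compAddMonoidHom
    (Algebra.trace (ZMod p) K).toAddMonoidHom
  have hψ : ∀ x, ψ x = ZMod.stdAddChar (Algebra.trace (ZMod p) K x) := fun _ => rfl
  have hprim : ψ.IsPrimitive := traceAddChar_isPrimitive
  have hGsq := sum_quadraticChar_mul_sq hchar hprim
  have hG := sum_quadraticChar_mul_stdAddChar_trace hp hK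
  simp_rw [← hψ] at hG
  set G : ℂ := ∑ x : K, (quadraticChar K x : ℂ) * ψ x with hG_def
  have hηsq : ((quadraticChar K (-1) : ℤ) : ℂ) ^ 2 = 1 := by
    rw [← Int.cast_pow, quadraticChar_sq_one (neg_ne_zero.mpr one_ne_zero), Int.cast_one]
  have hηsum : ∑ c : K, (quadraticChar K c : ℂ) = 0 := by
    rw [← Int.cast_sum, quadraticChar_sum_zero hchar, Int.cast_zero]
  have hroot : (Real.sqrt ((p : ℝ) ^ n) : ℂ) = (p : ℂ) ^ ((n - m) / 2) * (Real.sqrt p : ℂ) ^ m := by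
    rw [Real.sqrt_eq_rpow, ← Real.rpow_natCast_mul hppos.le, mul_comm,
      Real.rpow_mul_natCast hppos.le, ← Real.sqrt_eq_rpow, Complex.ofReal_pow, ← hsqrt, ← pow_mul,
      ← pow_add]
    congr 1
    obtain ⟨k, hk⟩ := hnm
    omega
  set S : ℂ := (Real.sqrt ((p : ℝ) ^ n) : ℂ) with hS
  have hexp : ∀ c : K, ∑ x : V, ψ (c * F x)
      = (if c = 0 then (p : ℂ) ^ n else 0) + υ * S * (quadraticChar K c : ℂ) := by
    intro c
    rcases eq_or_ne c 0 with rfl | hc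
    · simp [hV]
    · have := hWalsh c hc 0
      simp only [map_zero, LinearMap.zero_apply, sub_zero, hFstar0, mul_zero,
        zetaP_eq_stdAddChar, ← hψ, AddChar.map_zero_eq_one, mul_one] at this
      rw [this, if_neg hc]
      ring
  have hcount : (p : ℂ) ^ m * (#{x : V | F x = 0} : ℂ) = (p : ℂ) ^ n := by
    have h1 : ∑ c : K, ∑ x : V, ψ (c * F x) = (p : ℂ) ^ n := by
      simp_rw [hexp]
      rw [Finset.sum_add_distrib, ← Finset.mul_sum, hηsum, mul_zero, add_zero]
      simp
    rw [Finset.sum_comm] at h1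
    rw [← h1]
    simp_rw [AddChar.sum_mulShift _ hprim, hK]
    push_cast
    rw [Finset.sum_ite, Finset.sum_const, Finset.sum_const_zero, add_zero, nsmul_eq_mul, mul_comm]
  have hcount' : (#{x : V | F x = 0} : ℂ) = (p : ℂ) ^ (n - m) := by
    apply mul_left_cancel₀ (pow_ne_zero m hp0)
    rw [hcount, ← pow_add, Nat.add_sub_cancel' hmn]
  have hT : (∑ x : V, (quadraticChar K (F x) : ℂ)) * G = υ * S * ((p : ℂ) ^ m - 1) := by
    have h1 : ∑ c : K, (quadraticChar K c : ℂ) * ∑ x : V, ψ (c * F x)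
        = υ * S * ((p : ℂ) ^ m - 1) := by
      have h2 : ∀ c : K, (quadraticChar K c : ℂ) * ∑ x : V, ψ (c * F x)
          = υ * S * (1 - if c = 0 then 1 else 0) := by
        intro c
        rw [hexp]
        rcases eq_or_ne c 0 with rfl | hc
        · simp
        · have : ((quadraticChar K c : ℤ) : ℂ) ^ 2 = 1 := by
            rw [← Int.cast_pow, quadraticChar_sq_one hc, Int.cast_one]
          rw [if_neg hc, if_neg hc]
          linear_combination υ * S * this
      simp_rw [h2]
      rw [← Finset.mul_sum, Finset.sum_sub_distrib]
      simp [hK]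
    rw [← h1, Finset.sum_mul]
    simp_rw [Finset.mul_sum]
    rw [Finset.sum_comm]
    refine Finset.sum_congr rfl fun x _ => ?_
    rcases eq_or_ne (F x) 0 with h0 | h0
    · simp only [h0, mul_zero, AddChar.map_zero_eq_one, mul_one, hηsum, MulChar.map_zero,
        Int.cast_zero, zero_mul]
    · rw [hG_def, ← sum_quadraticChar_mul_mulShift ψ h0]
      exact Finset.sum_congr rfl fun c _ => by rw [mul_comm (F x)]
  have hTval : ∑ x : V, (quadraticChar K (F x) : ℂ)
      = (-1) ^ (m - 1) * epsC p ^ m * (quadraticChar K (-1) : ℂ) * υ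
            * (p : ℂ) ^ ((n - m) / 2) * ((p : ℂ) ^ m - 1) := by
    rw [hK, Nat.cast_pow] at hGsq
    apply mul_right_cancel₀ (pow_ne_zero m hp0)
    have hrm : ((Real.sqrt p : ℂ) ^ m) ^ 2 = (p : ℂ) ^ m := by
      rw [← pow_mul, mul_comm, pow_mul, hsqrt]
    rw [hroot] at hT
    set T := ∑ x : V, (quadraticChar K (F x) : ℂ)
    set η : ℂ := ((quadraticChar K (-1) : ℤ) : ℂ)
    set w := (Real.sqrt p : ℂ) ^ m
    set Q := (p : ℂ) ^ m
    set e := (p : ℂ) ^ ((n - m) / 2)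
    linear_combination (-T * Q) * hηsq - η * T * hGsq + η * G * hT + η * υ * e * w * (Q - 1) * hG
      + η * υ * e * (Q - 1) * ((-1) ^ (m - 1) * epsC p ^ m) * hrm
  have hsplit : ∀ x : V, (quadraticChar K (F x) : ℂ)
      = (if IsSquare (F x) ∧ F x ≠ 0 then 1 else 0) - (if ¬ IsSquare (F x) then 1 else 0) := by
    intro x
    rcases eq_or_ne (F x) 0 with h0 | h0
    · simp [h0]
    · by_cases hs : IsSquare (F x)
      · simp [h0, hs, (quadraticChar_one_iff_isSquare h0).mpr hs]
      · simp [hs, quadraticChar_neg_one_iff_not_isSquare.mpr hs]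
  have hpart : ∀ x : V, (1 : ℂ) = (if F x = 0 then 1 else 0)
      + (if IsSquare (F x) ∧ F x ≠ 0 then 1 else 0) + (if ¬ IsSquare (F x) then 1 else 0) := by
    intro x
    rcases eq_or_ne (F x) 0 with h0 | h0
    · simp [h0]
    · by_cases hs : IsSquare (F x) <;> simp [h0, hs]
  have hdiff := Finset.sum_congr (rfl : (univ : Finset V) = univ) fun x _ => hsplit x
  have htotal := Finset.sum_congr (rfl : (univ : Finset V) = univ) fun x _ => hpart x
  rw [Finset.sum_sub_distrib, Finset.sum_boole, Finset.sum_boole, hTval] at hdiff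
  rw [Finset.sum_add_distrib, Finset.sum_add_distrib, Finset.sum_boole, Finset.sum_boole,
    Finset.sum_boole, hcount', Finset.sum_const, Finset.card_univ, hV, nsmul_eq_mul, mul_one,
    Nat.cast_pow, ← Nat.sub_add_cancel hmn, pow_add, Nat.add_sub_cancel] at htotal
  constructor
  · linear_combination -hdiff - htotal
  · linear_combination hdiff - htotal
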